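/- arXiv:0801.0313 — 2 statements merged into one kernel-verified Lean document; each statement's English description precedes it below -/
import Mathlib

section
/- Let Ω be a locally compact Hausdorff space, let 𝔓 be a relatively compact family of prime ideals in C_0(Ω), and let 𝔔 be the collection of all ideals that are unions of countably many ideals of 𝔓. Then 𝔔 is a compact family of prime ideals, and every element of 𝔔 is the union of some pseudo-finite sequence of ideals of 𝔓. -/
open ZeroAtInfty

/-- `I` is an ideal of a non-unital commutative ring (as a set). -/
def IsIdeal {A : Type*} [NonUnitalCommRing A] (I : Set A) : Prop :=
  (0 : A) ∈ I ∧ (∀ a ∈ I, ∀ b ∈ I, a + b ∈ I) ∧ (∀ a ∈ I, -a ∈ I) ∧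
    ∀ a ∈ I, ∀ b : A, a * b ∈ I

/-- `I` is a prime ideal of a non-unital commutative ring: a proper ideal such
that `a * b ∈ I` implies `a ∈ I` or `b ∈ I`. -/
def IsPrimeIdeal {A : Type*} [NonUnitalCommRing A] (I : Set A) : Prop :=
  IsIdeal I ∧ I ≠ Set.univ ∧ ∀ a b : A, a * b ∈ I → a ∈ I ∨ b ∈ I

/-- A sequence of sets is pseudo-finite if every element of the union lies in
all but finitely many of the sets. -/
def PseudoFinite {A : Type*} [NonUnitalCommRing A] (P : ℕ → Set A) : Prop :=
  ∀ a : A, (∃ n, a ∈ P n) → {n | a ∉ P n}.Finite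

/-- A family of prime ideals is relatively compact if every sequence in the
family has a pseudo-finite subsequence. -/
def RelativelyCompactFamily {A : Type*} [NonUnitalCommRing A]
    (𝔓 : Set (Set A)) : Prop :=
  (∀ P ∈ 𝔓, IsPrimeIdeal P) ∧
    ∀ P : ℕ → Set A, (∀ n, P n ∈ 𝔓) →
      ∃ φ : ℕ → ℕ, StrictMono φ ∧ PseudoFinite (fun n => P (φ n))

/-- A family of prime ideals is compact if it is relatively compact and
contains the union of each of its pseudo-finite sequences. -/
def CompactFamily {A : Type*} [NonUnitalCommRing A] (𝔔 : Set (Set A)) : Prop :=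
  RelativelyCompactFamily 𝔔 ∧
    ∀ P : ℕ → Set A, (∀ n, P n ∈ 𝔔) → PseudoFinite P → (⋃ n, P n) ∈ 𝔔

open Filter Topology

theorem IsIdeal.sum_mem {A ι : Type*} [NonUnitalCommRing A] {I : Set A} (hI : IsIdeal I)
    (s : Finset ι) (f : ι → A) (hf : ∀ i ∈ s, f i ∈ I) : ∑ i ∈ s, f i ∈ I :=
  Finset.sum_induction f (· ∈ I) (fun a b ha hb => hI.2.1 a ha b hb) hI.1 hf

theorem pseudoFinite_iff_eventually {A : Type*} [NonUnitalCommRing A] {P : ℕ → Set A} :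
    PseudoFinite P ↔ ∀ a ∈ ⋃ n, P n, ∀ᶠ n in atTop, a ∈ P n := by
  simp only [PseudoFinite, ← Nat.cofinite_eq_atTop, eventually_cofinite, Set.mem_iUnion]

theorem PseudoFinite.isIdeal_iUnion {A : Type*} [NonUnitalCommRing A] {P : ℕ → Set A}
    (hP : PseudoFinite P) (hI : ∀ n, IsIdeal (P n)) : IsIdeal (⋃ n, P n) := by
  rw [pseudoFinite_iff_eventually] at hP
  refine ⟨Set.mem_iUnion.2 ⟨0, (hI 0).1⟩, fun a ha b hb => ?_, fun a ha => ?_, fun a ha b => ?_⟩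
  · obtain ⟨n, h₁, h₂⟩ := ((hP a ha).and (hP b hb)).exists
    exact Set.mem_iUnion.2 ⟨n, (hI n).2.1 a h₁ b h₂⟩
  · obtain ⟨n, h₁⟩ := Set.mem_iUnion.1 ha
    exact Set.mem_iUnion.2 ⟨n, (hI n).2.2.1 a h₁⟩
  · obtain ⟨n, h₁⟩ := Set.mem_iUnion.1 ha
    exact Set.mem_iUnion.2 ⟨n, (hI n).2.2.2 a h₁ b⟩

namespace ZeroAtInftyContinuousMap

variable {Ω : Type*} [TopologicalSpace Ω]

/-- If `f` is dominated by a multiple of `F`, then `F` divides `f * f`. -/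
theorem exists_mul_self_eq_mul {f F : C₀(Ω, ℂ)} {C : ℝ} (h : ∀ x, ‖f x‖ ≤ C * ‖F x‖) :
    ∃ g : C₀(Ω, ℂ), f * f = F * g := by
  have hg : ∀ x, ‖f x * f x / F x‖ ≤ C * ‖f x‖ := fun x => by
    rcases eq_or_ne (F x) 0 with hF | hF
    · have hf : f x = 0 := by simpa [hF] using h x
      simp [hf]
    · rw [norm_div, norm_mul, div_le_iff₀ (norm_pos_iff.2 hF)]
      nlinarith [mul_le_mul_of_nonneg_left (h x) (norm_nonneg (f x))]
  refine ⟨⟨⟨fun x => f x * f x / F x, continuous_iff_continuousAt.2 fun x => ?_⟩, ?_⟩, ?_⟩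
  · rcases eq_or_ne (F x) 0 with hF | hF
    · have hf : f x = 0 := by simpa [hF] using h x
      have h₀ : Tendsto (fun y => C * ‖f y‖) (𝓝 x) (𝓝 0) := by
        simpa [hf] using ((map_continuous f).norm.const_mul C).tendsto x
      simpa [ContinuousAt, hf] using squeeze_zero_norm hg h₀
    · exact (((map_continuous f).mul (map_continuous f)).continuousAt).div
        (map_continuous F).continuousAt hF
  · refine squeeze_zero_norm hg ?_
    simpa using (zero_at_infty f).norm.const_mul C
  · ext x
    rcases eq_or_ne (F x) 0 with hF | hF
    · have hf : f x = 0 := by simpa [hF] using h x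
      simp [hf, hF]
    · exact (mul_div_cancel₀ (f x * f x) hF).symm

theorem _root_.IsPrimeIdeal.mem_of_norm_le {P : Set C₀(Ω, ℂ)} (hP : IsPrimeIdeal P)
    {f F : C₀(Ω, ℂ)} {C : ℝ} (h : ∀ x, ‖f x‖ ≤ C * ‖F x‖) (hF : F ∈ P) : f ∈ P := by
  obtain ⟨g, hg⟩ := exists_mul_self_eq_mul h
  exact or_self_iff.1 (hP.2.2 f f (hg ▸ hP.1.2.2.2 F hF g))

theorem _root_.IsPrimeIdeal.mem_of_norm_sq_le {P : Set C₀(Ω, ℂ)} (hP : IsPrimeIdeal P)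
    {f F : C₀(Ω, ℂ)} {C : ℝ} (h : ∀ x, ‖f x‖ ^ 2 ≤ C * ‖F x‖) (hF : F ∈ P) : f ∈ P :=
  or_self_iff.1 <| hP.2.2 f f <| hP.mem_of_norm_le (C := C)
    (fun x => by simpa [sq] using h x) hF

/-- Evaluation at a point as an additive homomorphism. -/
noncomputable def evalAddHom (x : Ω) : C₀(Ω, ℂ) →+ ℂ where
  toFun f := f x
  map_zero' := rfl
  map_add' _ _ := rfl

theorem evalAddHom_apply (x : Ω) (f : C₀(Ω, ℂ)) : evalAddHom x f = f x := rfl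

theorem continuous_evalAddHom (x : Ω) : Continuous (evalAddHom x) :=
  AddMonoidHomClass.continuous_of_bound (evalAddHom x) 1 fun f => by
    rw [one_mul]
    exact f.toBCF.norm_coe_le_norm x

theorem norm_sq_le_norm_sum_mul_star {ι : Type*} (s : Finset ι) (f : ι → C₀(Ω, ℂ)) {i : ι}
    (hi : i ∈ s) (x : Ω) : ‖f i x‖ ^ 2 ≤ ‖(∑ j ∈ s, f j * star (f j)) x‖ := by
  have h : (∑ j ∈ s, f j * star (f j)) x = ((∑ j ∈ s, ‖f j x‖ ^ 2 : ℝ) : ℂ) := by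
    refine (map_sum (evalAddHom x) _ s).trans ?_
    push_cast
    exact Finset.sum_congr rfl fun j _ => by simp [evalAddHom_apply, Complex.mul_conj']
  rw [h, Complex.norm_real]
  exact (Finset.single_le_sum (f := fun j => ‖f j x‖ ^ 2) (fun _ _ => by positivity) hi).trans
    (le_abs_self _)

theorem _root_.IsPrimeIdeal.mem_of_sum_mul_star_mem {ι : Type*} {P : Set C₀(Ω, ℂ)}
    (hP : IsPrimeIdeal P) {s : Finset ι} {f : ι → C₀(Ω, ℂ)}
    (h : ∑ j ∈ s, f j * star (f j) ∈ P) {i : ι} (hi : i ∈ s) : f i ∈ P :=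
  hP.mem_of_norm_sq_le (C := 1) (fun x => by
    simpa using norm_sq_le_norm_sum_mul_star s f hi x) h

theorem _root_.IsIdeal.sum_mul_star_mem {ι : Type*} {I : Set C₀(Ω, ℂ)} (hI : IsIdeal I)
    {s : Finset ι} {f : ι → C₀(Ω, ℂ)} (h : ∀ i ∈ s, f i ∈ I) :
    ∑ j ∈ s, f j * star (f j) ∈ I :=
  hI.sum_mem s _ fun i hi => hI.2.2.2 _ (h i hi) _

/-- The positive part of `|f| - |g|`. -/
noncomputable def normSubPos (f g : C₀(Ω, ℂ)) : C₀(Ω, ℂ) where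
  toFun x := ((max (‖f x‖ - ‖g x‖) 0 : ℝ) : ℂ)
  continuous_toFun := by
    have := map_continuous f
    have := map_continuous g
    fun_prop
  zero_at_infty' := by
    have h : Tendsto (fun x => max (‖f x‖ - ‖g x‖) 0) (cocompact Ω) (𝓝 0) := by
      simpa using ((zero_at_infty f).norm.sub (zero_at_infty g).norm).max
        (tendsto_const_nhds (x := (0 : ℝ)))
    simpa [Function.comp_def] using (Complex.continuous_ofReal.tendsto 0).comp h

theorem normSubPos_apply (f g : C₀(Ω, ℂ)) (x : Ω) :
    normSubPos f g x = ((max (‖f x‖ - ‖g x‖) 0 : ℝ) : ℂ) := rfl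

theorem normSubPos_mul_normSubPos (f g : C₀(Ω, ℂ)) :
    normSubPos f g * normSubPos g f = 0 := by
  ext x
  rcases le_total ‖f x‖ ‖g x‖ with h | h <;> simp [normSubPos_apply, h]

theorem _root_.IsPrimeIdeal.mem_of_normSubPos_mem {P : Set C₀(Ω, ℂ)} (hP : IsPrimeIdeal P)
    {f g : C₀(Ω, ℂ)} (h : normSubPos f g ∈ P) (hg : g ∈ P) : f ∈ P := by
  have hmem := hP.1.sum_mul_star_mem (s := Finset.univ) (f := ![normSubPos f g, g])
    (by simp [Fin.forall_fin_two, h, hg])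
  refine hP.mem_of_norm_sq_le (C := 4) (fun x => ?_) hmem
  have h₀ := norm_sq_le_norm_sum_mul_star Finset.univ ![normSubPos f g, g]
    (Finset.mem_univ 0) x
  have h₁ := norm_sq_le_norm_sum_mul_star Finset.univ ![normSubPos f g, g]
    (Finset.mem_univ 1) x
  simp only [Matrix.cons_val_zero, Matrix.cons_val_one] at h₀ h₁
  have h₂ : ‖f x‖ ≤ ‖normSubPos f g x‖ + ‖g x‖ := by
    rw [normSubPos_apply, Complex.norm_real, Real.norm_eq_abs]
    linarith [le_max_left (‖f x‖ - ‖g x‖) 0, le_abs_self (max (‖f x‖ - ‖g x‖) 0)]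
  nlinarith [norm_nonneg (f x), sq_nonneg (‖normSubPos f g x‖ - ‖g x‖)]

/-- The prime ideals of `C₀(Ω)` that contain a given prime ideal form a chain. -/
theorem _root_.IsPrimeIdeal.subset_or_subset {P I J : Set C₀(Ω, ℂ)} (hP : IsPrimeIdeal P)
    (hI : IsPrimeIdeal I) (hJ : IsPrimeIdeal J) (hPI : P ⊆ I) (hPJ : P ⊆ J) :
    I ⊆ J ∨ J ⊆ I := by
  by_contra! h
  obtain ⟨⟨f, hfI, hfJ⟩, g, hgJ, hgI⟩ :=
    And.intro (Set.not_subset.1 h.1) (Set.not_subset.1 h.2)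
  rcases hP.2.2 _ _ (normSubPos_mul_normSubPos f g ▸ hP.1.1) with h | h
  · exact hfJ (hJ.mem_of_normSubPos_mem (hPJ h) hgJ)
  · exact hgI (hI.mem_of_normSubPos_mem (hPI h) hfI)

/-- Countably many prime ideals of `C₀(Ω)` do not cover `C₀(Ω)`. -/
theorem exists_forall_notMem_of_isPrimeIdeal {P : ℕ → Set C₀(Ω, ℂ)}
    (hP : ∀ n, IsPrimeIdeal (P n)) : ∃ F : C₀(Ω, ℂ), ∀ n, F ∉ P n := by
  choose f hf using fun n => (Set.ne_univ_iff_exists_notMem _).1 (hP n).2.1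
  let c : ℕ → ℝ := fun n => (1 / 2) ^ n / (1 + ‖f n‖ ^ 2)
  have hc : ∀ n, 0 < c n := fun n => by positivity
  let u : ℕ → C₀(Ω, ℂ) := fun n => (c n : ℂ) • (f n * star (f n))
  have hu : Summable u := by
    refine Summable.of_norm_bounded (g := fun n => (1 / 2 : ℝ) ^ n) summable_geometric_two
      fun n => ?_
    have hn : ‖f n * star (f n)‖ = ‖f n‖ * ‖f n‖ := CStarRing.norm_self_mul_star
    rw [norm_smul, hn, Complex.norm_real, Real.norm_of_nonneg (hc n).le,
      div_mul_eq_mul_div, div_le_iff₀ (by positivity)]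
    gcongr
    nlinarith
  have hux : ∀ n x, u n x = ((c n * ‖f n x‖ ^ 2 : ℝ) : ℂ) := fun n x => by
    simp [u, Complex.mul_conj']
  refine ⟨∑' n, u n, fun n hn => hf n ((hP n).mem_of_norm_sq_le (C := (c n)⁻¹) (fun x => ?_) hn)⟩
  have hx : HasSum (fun n => u n x) ((∑' n, u n) x) :=
    hu.hasSum.map (evalAddHom x) (continuous_evalAddHom x)
  simp only [hux] at hx
  have hre := Complex.hasSum_re hx
  simp only [Complex.ofReal_re] at hre
  have hle : c n * ‖f n x‖ ^ 2 ≤ ‖(∑' n, u n) x‖ :=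
    (le_hasSum hre n fun m _ => mul_nonneg (hc m).le (sq_nonneg _)).trans
      ((le_abs_self _).trans (Complex.abs_re_le_norm _))
  rwa [inv_mul_eq_div, le_div_iff₀' (hc n)]

theorem isPrimeIdeal_iUnion {P : ℕ → Set C₀(Ω, ℂ)} (hP : ∀ n, IsPrimeIdeal (P n))
    (hI : IsIdeal (⋃ n, P n)) : IsPrimeIdeal (⋃ n, P n) := by
  refine ⟨hI, (Set.ne_univ_iff_exists_notMem _).2 ?_, fun a b hab => ?_⟩
  · simpa using exists_forall_notMem_of_isPrimeIdeal hP
  · obtain ⟨n, hn⟩ := Set.mem_iUnion.1 hab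
    exact ((hP n).2.2 a b hn).imp (Set.mem_iUnion_of_mem n) (Set.mem_iUnion_of_mem n)

theorem _root_.PseudoFinite.isPrimeIdeal_iUnion {P : ℕ → Set C₀(Ω, ℂ)} (h : PseudoFinite P)
    (hP : ∀ n, IsPrimeIdeal (P n)) : IsPrimeIdeal (⋃ n, P n) :=
  ZeroAtInftyContinuousMap.isPrimeIdeal_iUnion hP (h.isIdeal_iUnion fun n => (hP n).1)

/-- A sequence `Q` of prime ideals has a pseudo-finite subsequence as soon as there are elements
`d n` of ideals of `𝔓` below `Q n` such that, along any subsequence, no term after the first one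
contains all of them. -/
theorem exists_pseudoFinite_of_notMem {𝔓 : Set (Set C₀(Ω, ℂ))} (h𝔓 : RelativelyCompactFamily 𝔓)
    {Q : ℕ → Set C₀(Ω, ℂ)} (hQ : ∀ n, IsPrimeIdeal (Q n)) {d : ℕ → C₀(Ω, ℂ)}
    (hdP : ∀ n, ∃ P ∈ 𝔓, d n ∈ P ∧ P ⊆ Q n)
    (hd : ∀ φ : ℕ → ℕ, StrictMono φ → ∀ k, ∃ l, d (φ l) ∉ Q (φ (k + 1))) :
    ∃ φ : ℕ → ℕ, StrictMono φ ∧ PseudoFinite fun n => Q (φ n) := by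
  choose P hP𝔓 hdP hPQ using hdP
  obtain ⟨φ, hφ, hpf⟩ := h𝔓.2 P hP𝔓
  have hprime : ∀ n, IsPrimeIdeal (P n) := fun n => h𝔓.1 _ (hP𝔓 n)
  have hR := hpf.isPrimeIdeal_iUnion fun n => hprime (φ n)
  have hQR : ∀ k, Q (φ (k + 1)) ⊆ ⋃ n, P (φ n) := fun k => by
    refine ((hprime (φ (k + 1))).subset_or_subset (hQ _) hR (hPQ _)
      (Set.subset_iUnion (fun n => P (φ n)) (k + 1))).resolve_right fun h => ?_
    obtain ⟨l, hl⟩ := hd φ hφ k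
    exact hl (h (Set.mem_iUnion_of_mem l (hdP _)))
  refine ⟨fun k => φ (k + 1), hφ.comp (strictMono_id.add_const 1), ?_⟩
  rw [pseudoFinite_iff_eventually] at hpf ⊢
  intro a ha
  exact ((tendsto_add_atTop_nat 1).eventually (hpf a (Set.iUnion_subset hQR ha))).mono
    fun n hn => hPQ _ hn

theorem exists_pseudoFinite_of_iUnion {𝔓 : Set (Set C₀(Ω, ℂ))} (h𝔓 : RelativelyCompactFamily 𝔓)
    {Q : ℕ → Set C₀(Ω, ℂ)} (hQ : ∀ n, IsPrimeIdeal (Q n))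
    (hQP : ∀ n, ∀ a ∈ Q n, ∃ P ∈ 𝔓, a ∈ P ∧ P ⊆ Q n) :
    ∃ φ : ℕ → ℕ, StrictMono φ ∧ PseudoFinite fun n => Q (φ n) := by
  suffices H : ∃ g : ℕ → ℕ, StrictMono g ∧
      ∃ φ : ℕ → ℕ, StrictMono φ ∧ PseudoFinite fun n => Q (g (φ n)) by
    obtain ⟨g, hg, φ, hφ, h⟩ := H
    exact ⟨g ∘ φ, hg.comp hφ, h⟩
  obtain ⟨g, hg⟩ := exists_increasing_or_nonincreasing_subseq (fun a b : Set C₀(Ω, ℂ) => b ⊂ a) Q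
  refine ⟨g, g.strictMono, ?_⟩
  rcases hg with hg | hg
  · choose d hd hd' using fun n => Set.exists_of_ssubset (hg n (n + 1) n.lt_succ_self)
    refine exists_pseudoFinite_of_notMem h𝔓 (fun n => hQ (g n)) (d := d)
      (fun n => hQP _ _ (hd n)) fun φ hφ k => ⟨0, fun h => hd' (φ 0) ?_⟩
    rcases (Nat.succ_le_of_lt (hφ k.succ_pos)).eq_or_lt with h' | h'
    · rwa [← h'] at h
    · exact (hg _ _ h').1 h
  · obtain ⟨e, he⟩ := exists_increasing_or_nonincreasing_subseq
      (fun a b : Set C₀(Ω, ℂ) => a = b) fun n => Q (g n)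
    rcases he with he | he
    · refine ⟨e, e.strictMono, fun a ⟨n, hn⟩ => ?_⟩
      have hconst : ∀ m, Q (g (e m)) = Q (g (e 0)) := fun m => by
        rcases m.eq_zero_or_pos with rfl | hm
        · rfl
        · exact (he 0 m hm).symm
      simp only [hconst] at hn ⊢
      simp [hn]
    · have hnot : ∀ m n, m < n → ∃ a ∈ Q (g (e n)), a ∉ Q (g (e m)) := fun m n hmn => by
        refine Set.not_subset.1 fun h => hg _ _ (e.strictMono hmn) (h.ssubset_of_ne ?_)
        exact Ne.symm (he m n hmn)
      choose! a ha ha' using hnot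
      obtain ⟨φ, hφ, h⟩ := exists_pseudoFinite_of_notMem h𝔓 (fun n => hQ (g (e n)))
        (d := fun n => ∑ m ∈ Finset.range n, a m n * star (a m n))
        (fun n => hQP _ _ ((hQ _).1.sum_mul_star_mem fun m hm => ha m n (Finset.mem_range.1 hm)))
        fun φ hφ k => ⟨k + 2, fun h => ha' _ _ (hφ (k + 1).lt_succ_self)
          ((hQ _).mem_of_sum_mul_star_mem h (Finset.mem_range.2 (hφ (k + 1).lt_succ_self)))⟩
      exact ⟨e ∘ φ, e.strictMono.comp hφ, h⟩

/-- If the ideal `Q` is a countable union of prime ideals of a relatively compact family, any two of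
which are contained in a common prime ideal that does not contain `Q`, then `Q` is the union of a
pseudo-finite sequence of these ideals. -/
theorem exists_pseudoFinite_of_common_prime {𝔓 : Set (Set C₀(Ω, ℂ))}
    (h𝔓 : RelativelyCompactFamily 𝔓) {Q : Set C₀(Ω, ℂ)} (hQ : IsIdeal Q) {ι : Type*} [Countable ι]
    {P : ι → Set C₀(Ω, ℂ)} (hP : ∀ i, P i ∈ 𝔓) (hQP : Q = ⋃ i, P i)
    (h : ∀ i j, ∃ T, IsPrimeIdeal T ∧ ¬ Q ⊆ T ∧ P i ⊆ T ∧ P j ⊆ T) :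
    ∃ s : ℕ → ι, PseudoFinite (fun n => P (s n)) ∧ Q = ⋃ n, P (s n) := by
  have hmem : ∀ a ∈ Q, ∃ i, a ∈ P i := fun a ha => Set.mem_iUnion.1 (hQP ▸ ha)
  have : Nonempty ι := (hmem 0 hQ.1).nonempty
  choose T hT hQT hPT hPT' using h
  choose f hfQ hfT using fun i j => Set.not_subset.1 (hQT i j)
  obtain ⟨p, hp⟩ := exists_surjective_nat (ι × ι)
  choose s hs using fun n => hmem _ (hQ.sum_mul_star_mem (s := Finset.range n)
    (f := fun k => f (p k).1 (p k).2) fun _ _ => hfQ _ _)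
  obtain ⟨φ, hφ, hpf⟩ := h𝔓.2 (fun n => P (s n)) fun n => hP _
  have hR := hpf.isPrimeIdeal_iUnion fun n => h𝔓.1 _ (hP _)
  have hfR : ∀ i j, f i j ∈ ⋃ n, P (s (φ n)) := fun i j => by
    obtain ⟨k, hk⟩ := hp (i, j)
    have := (h𝔓.1 _ (hP _)).mem_of_sum_mul_star_mem (hs (φ (k + 1)))
      (Finset.mem_range.2 (k.lt_succ_self.trans_le (hφ.le_apply)))
    rw [hk] at this
    exact Set.mem_iUnion_of_mem (k + 1) this
  refine ⟨s ∘ φ, hpf, (hQP.trans_subset (Set.iUnion_subset fun m => ?_)).antisymm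
    (hQP ▸ Set.iUnion_subset fun n => Set.subset_iUnion P (s (φ n)))⟩
  have hTR := ((h𝔓.1 _ (hP (s (φ 0)))).subset_or_subset (hT _ m) hR (hPT _ m)
    (Set.subset_iUnion (fun n => P (s (φ n))) 0)).resolve_right
      fun h => hfT _ m (h (hfR _ m))
  exact (hPT' _ m).trans hTR

theorem exists_pseudoFinite_eq_iUnion {𝔓 : Set (Set C₀(Ω, ℂ))} (h𝔓 : RelativelyCompactFamily 𝔓)
    {Q : Set C₀(Ω, ℂ)} (hQ : IsIdeal Q) {P : ℕ → Set C₀(Ω, ℂ)} (hP : ∀ n, P n ∈ 𝔓)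
    (hQP : Q = ⋃ n, P n) :
    ∃ s : ℕ → ℕ, PseudoFinite (fun n => P (s n)) ∧ Q = ⋃ n, P (s n) := by
  have hprime : ∀ n, IsPrimeIdeal (P n) := fun n => h𝔓.1 _ (hP n)
  have hPQ : ∀ n, P n ⊆ Q := fun n => hQP ▸ Set.subset_iUnion P n
  have hmem : ∀ a ∈ Q, ∃ i, a ∈ P i := fun a ha => Set.mem_iUnion.1 (hQP ▸ ha)
  by_cases hex : ∃ n, Q ⊆ P n
  · obtain ⟨n, hn⟩ := hex
    exact ⟨fun _ => n, fun a ⟨_, ha⟩ => by simp [ha],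
      by simpa only [Set.iUnion_const] using hn.antisymm (hPQ n)⟩
  push Not at hex
  let r : Setoid ℕ :=
    { r := fun i j => ∃ T, IsPrimeIdeal T ∧ ¬ Q ⊆ T ∧ P i ⊆ T ∧ P j ⊆ T
      iseqv :=
        { refl := fun i => ⟨P i, hprime i, hex i, subset_rfl, subset_rfl⟩
          symm := fun ⟨T, h₁, h₂, h₃, h₄⟩ => ⟨T, h₁, h₂, h₄, h₃⟩
          trans := by
            rintro i j k ⟨T, h₁, h₂, h₃, h₄⟩ ⟨U, k₁, k₂, k₃, k₄⟩
            rcases (hprime j).subset_or_subset h₁ k₁ h₄ k₃ with h | h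
            · exact ⟨U, k₁, k₂, h₃.trans h, k₄⟩
            · exact ⟨T, h₁, h₂, h₃, k₄.trans h⟩ } }
  rcases finite_or_infinite (Quotient r) with hfin | hinf
  · have := Fintype.ofFinite (Quotient r)
    obtain ⟨c, hc⟩ : ∃ c : Quotient r, ∀ a ∈ Q, ∃ n, Quotient.mk r n = c ∧ a ∈ P n := by
      by_contra! hcon
      choose a haQ ha using hcon
      obtain ⟨n, hn⟩ := hmem _ (hQ.sum_mul_star_mem (s := Finset.univ) fun c _ => haQ c)
      exact ha _ n rfl ((hprime n).mem_of_sum_mul_star_mem hn (Finset.mem_univ _))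
    obtain ⟨s, hs, hs'⟩ := exists_pseudoFinite_of_common_prime h𝔓 hQ
      (P := fun i : {n // Quotient.mk r n = c} => P i) (fun i => hP i)
      (Set.Subset.antisymm (fun a ha => by
        obtain ⟨n, hn, han⟩ := hc a ha
        exact Set.mem_iUnion.2 ⟨⟨n, hn⟩, han⟩) (Set.iUnion_subset fun i => hPQ i))
      fun i j => Quotient.exact (i.2.trans j.2.symm)
    exact ⟨fun n => s n, hs, hs'⟩
  · let s : ℕ → ℕ := fun n => (Infinite.natEmbedding (Quotient r) n).out
    obtain ⟨φ, hφ, hpf⟩ := h𝔓.2 (fun n => P (s n)) fun n => hP _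
    refine ⟨fun n => s (φ n), hpf, Set.Subset.antisymm ?_ (Set.iUnion_subset fun n => hPQ _)⟩
    by_contra hcon
    have hrel : r.r (s (φ 0)) (s (φ 1)) :=
      ⟨_, hpf.isPrimeIdeal_iUnion fun n => hprime _, hcon,
        Set.subset_iUnion (fun n => P (s (φ n))) 0, Set.subset_iUnion (fun n => P (s (φ n))) 1⟩
    have heq := Quotient.sound (s := r) hrel
    simp only [s, Quotient.out_eq, EmbeddingLike.apply_eq_iff_eq] at heq
    exact absurd (hφ.injective heq) zero_ne_one

end ZeroAtInftyContinuousMap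

/-- Let `𝔓` be a relatively compact family of prime ideals in `C₀(Ω)` and let
`𝔔` be the collection of all ideals that are unions of countably many ideals
of `𝔓`. Then `𝔔` is a compact family of prime ideals, and every member of
`𝔔` is the union of a pseudo-finite sequence of ideals of `𝔓`. -/
theorem closure_is_compactFamily {Ω : Type*} [TopologicalSpace Ω]
    [LocallyCompactSpace Ω] [T2Space Ω]
    (𝔓 : Set (Set C₀(Ω, ℂ))) (h𝔓 : RelativelyCompactFamily 𝔓) (hne : 𝔓.Nonempty)
    (𝔔 : Set (Set C₀(Ω, ℂ)))
    (h𝔔 : 𝔔 = {Q | IsIdeal Q ∧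
      ∃ P : ℕ → Set C₀(Ω, ℂ), (∀ n, P n ∈ 𝔓) ∧ Q = ⋃ n, P n}) :
    CompactFamily 𝔔 ∧
      ∀ Q ∈ 𝔔, ∃ P : ℕ → Set C₀(Ω, ℂ),
        (∀ n, P n ∈ 𝔓) ∧ PseudoFinite P ∧ Q = ⋃ n, P n := by
  subst h𝔔
  have hprime : ∀ Q ∈ {Q | IsIdeal Q ∧ ∃ P : ℕ → Set C₀(Ω, ℂ), (∀ n, P n ∈ 𝔓) ∧ Q = ⋃ n, P n},
      IsPrimeIdeal Q := by
    rintro _ ⟨hQ, P, hP, rfl⟩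
    exact ZeroAtInftyContinuousMap.isPrimeIdeal_iUnion (fun n => h𝔓.1 _ (hP n)) hQ
  refine ⟨⟨⟨hprime, fun Q hQ => ?_⟩, fun Q hQ hpf => ?_⟩, ?_⟩
  · refine ZeroAtInftyContinuousMap.exists_pseudoFinite_of_iUnion h𝔓 (fun n => hprime _ (hQ n))
      fun n a ha => ?_
    obtain ⟨-, P, hP, hQP⟩ := hQ n
    rw [hQP] at ha ⊢
    obtain ⟨k, hk⟩ := Set.mem_iUnion.1 ha
    exact ⟨P k, hP k, hk, Set.subset_iUnion P k⟩
  · refine ⟨hpf.isIdeal_iUnion fun n => (hQ n).1, ?_⟩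
    choose _ P hP hQP using hQ
    refine ⟨fun k => P k.unpair.1 k.unpair.2, fun k => hP _ _, ?_⟩
    rw [Set.iUnion_unpair]
    exact Set.iUnion_congr hQP
  · rintro Q ⟨hQ, P, hP, hQP⟩
    obtain ⟨s, hs, hs'⟩ :=
      ZeroAtInftyContinuousMap.exists_pseudoFinite_eq_iUnion h𝔓 hQ hP hQP
    exact ⟨fun n => P (s n), fun n => hP _, hs, hs'⟩
end

section
/- Let Ω be a locally compact Hausdorff space and 𝔔 a compact family of prime ideals in C_0(Ω). Call an ideal Q a roof of 𝔔 if Q is the union of the ideals in a maximal chain in 𝔔. Then 𝔔 has only finitely many roofs; in particular, only finitely many maximal modular ideals of C_0(Ω) contain an ideal of 𝔔. -/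
open ZeroAtInfty

/-- `Q` is a roof of `𝔔` if it is the union of the ideals in a maximal chain
in `𝔔`. -/
def IsRoof {A : Type*} [NonUnitalCommRing A] (𝔔 : Set (Set A)) (Q : Set A) :
    Prop :=
  ∃ 𝒞 ⊆ 𝔔, 𝒞.Nonempty ∧ IsChain (· ⊆ ·) 𝒞 ∧
    (∀ 𝒞' ⊆ 𝔔, IsChain (· ⊆ ·) 𝒞' → 𝒞 ⊆ 𝒞' → 𝒞' = 𝒞) ∧ Q = ⋃₀ 𝒞

/-- `M` is a maximal modular ideal: a proper modular ideal maximal among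
proper ideals. -/
def IsMaximalModularIdeal {A : Type*} [NonUnitalCommRing A] (M : Set A) :
    Prop :=
  IsIdeal M ∧ M ≠ Set.univ ∧ (∃ u : A, ∀ a : A, a - a * u ∈ M) ∧
    ∀ N : Set A, IsIdeal N → N ≠ Set.univ → M ⊆ N → N = M

/-- A continuous function dominated by a function vanishing at infinity vanishes at infinity. -/
lemma exists_zeroAtInfty_of_norm_le {Ω : Type*} [TopologicalSpace Ω] (f : C₀(Ω, ℂ))
    (F : Ω → ℂ) (hF : Continuous F) (h : ∀ x, ‖F x‖ ≤ ‖f x‖) :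
    ∃ k : C₀(Ω, ℂ), ∀ x, k x = F x :=
  ⟨⟨⟨F, hF⟩, squeeze_zero_norm h (by simpa using (zero_at_infty f).norm)⟩, fun _ => rfl⟩

/-- Prime ideals of `C₀(Ω)` are order ideals with respect to the modulus. -/
lemma IsPrimeIdeal.mem_of_norm_le_s15 {Ω : Type*} [TopologicalSpace Ω] {J : Set C₀(Ω, ℂ)}
    (hJ : IsPrimeIdeal J) {g h : C₀(Ω, ℂ)} (hg : g ∈ J) (hle : ∀ x, ‖h x‖ ≤ ‖g x‖) :
    h ∈ J := by
  have hk : ∀ x, ‖h x ^ 2 / g x‖ ≤ ‖h x‖ := fun x => by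
    rw [norm_div, norm_pow, sq]
    exact div_le_of_le_mul₀ (norm_nonneg _) (norm_nonneg _)
      (mul_le_mul_of_nonneg_left (hle x) (norm_nonneg _))
  have hcont : Continuous fun x => h x ^ 2 / g x := by
    rw [continuous_iff_continuousAt]
    intro x
    by_cases hx : g x = 0
    · have hh : h x = 0 := norm_le_zero_iff.1 (by simpa [hx] using hle x)
      have hlim := (map_continuous h).norm.tendsto x
      rw [hh, norm_zero] at hlim
      simpa [ContinuousAt, hx] using squeeze_zero_norm hk hlim
    · exact ((map_continuous h).continuousAt.pow 2).div (map_continuous g).continuousAt hx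
  obtain ⟨k, hk'⟩ := exists_zeroAtInfty_of_norm_le h _ hcont hk
  have hgk : g * k = h * h := by
    ext x
    simp only [ZeroAtInftyContinuousMap.mul_apply, hk']
    by_cases hx : g x = 0
    · have hh : h x = 0 := norm_le_zero_iff.1 (by simpa [hx] using hle x)
      simp [hx, hh]
    · field_simp
  exact or_self_iff.1 (hJ.2.2 h h (hgk ▸ hJ.1.2.2.2 g hg k))

/-- The prime ideals of `C₀(Ω)` containing a given prime ideal form a chain. -/
lemma IsPrimeIdeal.subset_or_subset_s15 {Ω : Type*} [TopologicalSpace Ω] {P I J : Set C₀(Ω, ℂ)}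
    (hP : IsPrimeIdeal P) (hI : IsPrimeIdeal I) (hJ : IsPrimeIdeal J)
    (hPI : P ⊆ I) (hPJ : P ⊆ J) : I ⊆ J ∨ J ⊆ I := by
  by_contra! hcon
  obtain ⟨⟨f, hfI, hfJ⟩, ⟨g, hgJ, hgI⟩⟩ :=
    And.intro (Set.not_subset.1 hcon.1) (Set.not_subset.1 hcon.2)
  have posPart (u v : C₀(Ω, ℂ)) :
      ∃ k : C₀(Ω, ℂ), ∀ x, k x = ((max (‖u x‖ - ‖v x‖) 0 : ℝ) : ℂ) := by
    refine exists_zeroAtInfty_of_norm_le u _ ?_ fun x => ?_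
    · have := map_continuous u
      have := map_continuous v
      fun_prop
    · rw [Complex.norm_real, Real.norm_of_nonneg (le_max_right _ _)]
      exact max_le (by linarith [norm_nonneg (v x)]) (norm_nonneg _)
  have absorb {K : Set C₀(Ω, ℂ)} (hK : IsPrimeIdeal K) {u v k : C₀(Ω, ℂ)} (hv : v ∈ K)
      (hkK : k ∈ K) (hk : ∀ x, k x = ((max (‖u x‖ - ‖v x‖) 0 : ℝ) : ℂ)) : u ∈ K := by
    have hcont : Continuous fun x => ((‖v x‖ : ℝ) : ℂ) := by
      have := map_continuous v
      fun_prop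
    obtain ⟨w, hw⟩ := exists_zeroAtInfty_of_norm_le v _ hcont (fun x => by simp)
    have hwK : w ∈ K := hK.mem_of_norm_le_s15 hv fun x => by simp [hw]
    refine hK.mem_of_norm_le_s15 (hK.1.2.1 k hkK w hwK) fun x => ?_
    rw [ZeroAtInftyContinuousMap.add_apply, hk, hw, ← Complex.ofReal_add, Complex.norm_real]
    refine le_trans ?_ (le_abs_self _)
    linarith [le_max_left (‖u x‖ - ‖v x‖) 0]
  obtain ⟨a, ha⟩ := posPart f g
  obtain ⟨b, hb⟩ := posPart g f
  have hab : a * b = 0 := by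
    ext x
    rw [ZeroAtInftyContinuousMap.mul_apply, ha, hb, ZeroAtInftyContinuousMap.zero_apply]
    rcases le_total ‖f x‖ ‖g x‖ with h | h
    · rw [max_eq_right (sub_nonpos.2 h)]; simp
    · rw [max_eq_right (sub_nonpos.2 h)]; simp
  rcases hP.2.2 a b (hab ▸ hP.1.1) with h | h
  · exact hfJ (absorb hJ hgJ (hPJ h) ha)
  · exact hgI (absorb hI hfI (hPI h) hb)

lemma IsMaximalModularIdeal.isPrimeIdeal {A : Type*} [NonUnitalCommRing A] {M : Set A}
    (hM : IsMaximalModularIdeal M) : IsPrimeIdeal M := by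
  obtain ⟨hI, hne, ⟨u, hu⟩, hmax⟩ := hM
  refine ⟨hI, hne, fun a b hab => ?_⟩
  obtain ⟨h0, hadd, hneg, hmul⟩ := hI
  have hN : IsIdeal {x | x * b ∈ M} := by
    refine ⟨by simpa using h0, fun x hx y hy => ?_, fun x hx => ?_, fun x hx y => ?_⟩
    · simpa [add_mul] using hadd _ hx _ hy
    · simpa using hneg _ hx
    · simpa [mul_right_comm] using hmul _ hx y
  by_cases hN' : {x | x * b ∈ M} = Set.univ
  · right
    have hub : u * b ∈ M := Set.eq_univ_iff_forall.1 hN' u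
    simpa [mul_comm] using hadd _ (hu b) _ hub
  · left
    rw [← hmax _ hN hN' fun x hx => hmul x hx b]
    exact hab

/-- Any sequence in a compact family has two terms at distinct indices
lying below a common member. -/
lemma CompactFamily.exists_common_upper_bound {A : Type*} [NonUnitalCommRing A]
    {𝔔 : Set (Set A)} (h𝔔 : CompactFamily 𝔔) (P : ℕ → Set A) (hP : ∀ n, P n ∈ 𝔔) :
    ∃ R ∈ 𝔔, ∃ m n, m ≠ n ∧ P m ⊆ R ∧ P n ⊆ R := by
  obtain ⟨φ, hφ, hpf⟩ := h𝔔.1.2 P hP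
  exact ⟨_, h𝔔.2 _ (fun n => hP (φ n)) hpf, φ 0, φ 1, (hφ zero_lt_one).ne,
    Set.subset_iUnion (fun n => P (φ n)) 0, Set.subset_iUnion (fun n => P (φ n)) 1⟩

/-- To show that a set of ideals related to a compact family is finite, it suffices that two of
them agree as soon as the associated members have a common upper bound. -/
lemma CompactFamily.finite_of_eq_of_upper_bound {A : Type*} [NonUnitalCommRing A]
    {𝔔 : Set (Set A)} (h𝔔 : CompactFamily 𝔔) {S : Set (Set A)} (r : Set A → Set A → Prop)
    (hr : ∀ Q ∈ S, ∃ P ∈ 𝔔, r P Q)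
    (heq : ∀ Q ∈ S, ∀ Q' ∈ S, ∀ P ∈ 𝔔, ∀ P' ∈ 𝔔, ∀ R ∈ 𝔔, r P Q → r P' Q' →
      P ⊆ R → P' ⊆ R → Q = Q') : S.Finite := by
  by_contra hinf
  let e := Set.Infinite.natEmbedding S hinf
  choose P hP hPr using fun n => hr (e n) (e n).2
  obtain ⟨R, hR, m, n, hmn, hm, hn⟩ := h𝔔.exists_common_upper_bound P hP
  exact hmn (e.injective (Subtype.ext
    (heq _ (e m).2 _ (e n).2 _ (hP m) _ (hP n) R hR (hPr m) (hPr n) hm hn)))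

/-- A roof is the union of the members of the family containing `R`, for any member `R` containing
an element of the maximal chain. -/
lemma exists_mem_forall_roof_eq {Ω : Type*} [TopologicalSpace Ω] {𝔔 : Set (Set C₀(Ω, ℂ))}
    (hprime : ∀ P ∈ 𝔔, IsPrimeIdeal P) {Q : Set C₀(Ω, ℂ)} (hQ : IsRoof 𝔔 Q) :
    ∃ P ∈ 𝔔, ∀ R ∈ 𝔔, P ⊆ R → Q = ⋃₀ {S ∈ 𝔔 | R ⊆ S} := by
  obtain ⟨𝒞, h𝒞, ⟨P, hP⟩, hchain, hmax, rfl⟩ := hQ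
  have hup : ∀ R ∈ 𝔔, P ⊆ R → R ∈ 𝒞 := fun R hR hPR => by
    rw [← hmax (insert R 𝒞) (Set.insert_subset hR h𝒞) (hchain.insert fun S hS _ => ?_)
      (Set.subset_insert _ _)]
    · exact Set.mem_insert _ _
    · rcases hchain.total hS hP with h | h
      · exact Or.inr (h.trans hPR)
      · exact (hprime P (h𝒞 hP)).subset_or_subset_s15 (hprime R hR) (hprime S (h𝒞 hS)) hPR h
  refine ⟨P, h𝒞 hP, fun R hR hPR => Set.Subset.antisymm ?_ ?_⟩
  · refine Set.sUnion_subset fun S hS => ?_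
    rcases hchain.total hS (hup R hR hPR) with h | h
    · exact h.trans (Set.subset_sUnion_of_mem ⟨hR, subset_rfl⟩)
    · exact Set.subset_sUnion_of_mem ⟨h𝒞 hS, h⟩
  · exact Set.sUnion_subset fun S hS => Set.subset_sUnion_of_mem (hup S hS.1 (hPR.trans hS.2))

/-- A compact family `𝔔` of prime ideals in `C₀(Ω)` has only finitely many
roofs; in particular only finitely many maximal modular ideals of `C₀(Ω)`
contain an ideal of `𝔔`. -/
theorem compactFamily_finitely_many_roofs {Ω : Type*} [TopologicalSpace Ω]
    [LocallyCompactSpace Ω] [T2Space Ω]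
    (𝔔 : Set (Set C₀(Ω, ℂ))) (h𝔔 : CompactFamily 𝔔) :
    {Q : Set C₀(Ω, ℂ) | IsRoof 𝔔 Q}.Finite ∧
      {M : Set C₀(Ω, ℂ) | IsMaximalModularIdeal M ∧ ∃ P ∈ 𝔔, P ⊆ M}.Finite := by
  have hprime := h𝔔.1.1
  constructor
  · refine h𝔔.finite_of_eq_of_upper_bound
      (fun P Q => ∀ R ∈ 𝔔, P ⊆ R → Q = ⋃₀ {S ∈ 𝔔 | R ⊆ S})
      (fun Q hQ => exists_mem_forall_roof_eq hprime hQ) ?_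
    intro Q _ Q' _ P _ P' _ R hR hPQ hPQ' hPR hPR'
    exact (hPQ R hR hPR).trans (hPQ' R hR hPR').symm
  · refine h𝔔.finite_of_eq_of_upper_bound (fun P M => P ⊆ M) (fun M hM => hM.2) ?_
    have hle : ∀ M, IsMaximalModularIdeal M → ∀ P ∈ 𝔔, ∀ R ∈ 𝔔, P ⊆ M → P ⊆ R → R ⊆ M := by
      intro M hM P hP R hR hPM hPR
      rcases (hprime P hP).subset_or_subset_s15 hM.isPrimeIdeal (hprime R hR) hPM hPR with h | h
      · exact (hM.2.2.2 R (hprime R hR).1 (hprime R hR).2.1 h).subset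
      · exact h
    intro M hM M' hM' P hP P' hP' R hR hPM hPM' hPR hPR'
    have hRM := hle M hM.1 P hP R hR hPM hPR
    have hRM' := hle M' hM'.1 P' hP' R hR hPM' hPR'
    rcases (hprime R hR).subset_or_subset_s15 hM.1.isPrimeIdeal hM'.1.isPrimeIdeal hRM hRM' with h | h
    · exact (hM.1.2.2.2 M' hM'.1.1 hM'.1.2.1 h).symm
    · exact hM'.1.2.2.2 M hM.1.1 hM.1.2.1 h
end
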